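/- arXiv:2112.10274 — 3 statements merged into one kernel-verified Lean document; each statement's English description precedes it below -/
import Mathlib

section
/- Suppose A and Y are conditionally independent given σ(Z), and suppose that for every measurable set B ⊆ α the conditional expectation μ⟦1_{A⁻¹(B)} | σ(Z)⟧ is μ-a.e. equal to μ⟦1_{A⁻¹(B)} | σ(f ∘ Z)⟧ (i.e., the conditional law of the treatment given the confounder Z is a function of f(Z) alone). Then A and Y are conditionally independent given σ(f ∘ Z). (This is the treatment-model case (ii) of the paper's Theorem 1: if P(A | Z) is γ(Z)-measurable and Z suffices to block the backdoor paths between A and Y, then γ(Z) also suffices.) -/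
open MeasureTheory

/-- If the conditional expectation of the product of `g` and `h` given `m₂` factors, and that of `g`
agrees with its conditional expectation given a coarser `m₁`, then the factorization holds given
`m₁`. -/
theorem condExp_eq_mul_of_condExp_eq_of_le {Ω : Type*} {m₁ m₂ m₀ : MeasurableSpace Ω}
    {μ : Measure Ω} [IsFiniteMeasure μ] (hm₁₂ : m₁ ≤ m₂) (hm₂ : m₂ ≤ m₀) {g h k : Ω → ℝ}
    (hk : μ[k | m₂] =ᵐ[μ] μ[g | m₂] * μ[h | m₂]) (hg : μ[g | m₂] =ᵐ[μ] μ[g | m₁]) :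
    μ[k | m₁] =ᵐ[μ] μ[g | m₁] * μ[h | m₁] := by
  have hprod : μ[k | m₂] =ᵐ[μ] μ[g | m₁] * μ[h | m₂] := hk.trans (hg.mul .rfl)
  calc
    μ[k | m₁] =ᵐ[μ] μ[μ[k | m₂] | m₁] := (condExp_condExp_of_le hm₁₂ hm₂).symm
    _ =ᵐ[μ] μ[μ[g | m₁] * μ[h | m₂] | m₁] := condExp_congr_ae hprod
    _ =ᵐ[μ] μ[g | m₁] * μ[μ[h | m₂] | m₁] :=
      condExp_mul_of_stronglyMeasurable_left stronglyMeasurable_condExp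
        (integrable_condExp.congr hprod) integrable_condExp
    _ =ᵐ[μ] μ[g | m₁] * μ[h | m₁] :=
      Filter.EventuallyEq.rfl.mul (condExp_condExp_of_le hm₁₂ hm₂)

/-- Treatment-model case (ii) of Theorem 1: if `A` and `Y` are conditionally independent
given `σ(Z)`, and the conditional law of `A` given `σ(Z)` coincides a.e. with that given
`σ(f ∘ Z)`, then `A` and `Y` are conditionally independent given `σ(f ∘ Z)`. -/
theorem condIndep_of_treatment_model
    {Ω α β γ γ' : Type*} [MeasurableSpace Ω] [StandardBorelSpace Ω]
    [MeasurableSpace α] [MeasurableSpace β] [MeasurableSpace γ] [MeasurableSpace γ']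
    (μ : Measure Ω) [IsProbabilityMeasure μ]
    {A : Ω → α} {Y : Ω → β} {Z : Ω → γ} {f : γ → γ'}
    (hA : Measurable A) (hY : Measurable Y) (hZ : Measurable Z) (hf : Measurable f)
    (hCI : ∀ (B : Set α) (C : Set β), MeasurableSet B → MeasurableSet C →
      μ[Set.indicator (A ⁻¹' B ∩ Y ⁻¹' C) (fun _ => (1 : ℝ)) |
          MeasurableSpace.comap Z inferInstance]
        =ᵐ[μ]
      μ[Set.indicator (A ⁻¹' B) (fun _ => (1 : ℝ)) | MeasurableSpace.comap Z inferInstance]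
        * μ[Set.indicator (Y ⁻¹' C) (fun _ => (1 : ℝ)) | MeasurableSpace.comap Z inferInstance])
    (hbal : ∀ (B : Set α), MeasurableSet B →
      μ[Set.indicator (A ⁻¹' B) (fun _ => (1 : ℝ)) | MeasurableSpace.comap Z inferInstance]
        =ᵐ[μ]
      μ[Set.indicator (A ⁻¹' B) (fun _ => (1 : ℝ)) |
          MeasurableSpace.comap (f ∘ Z) inferInstance]) :
    ∀ (B : Set α) (C : Set β), MeasurableSet B → MeasurableSet C →
      μ[Set.indicator (A ⁻¹' B ∩ Y ⁻¹' C) (fun _ => (1 : ℝ)) |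
          MeasurableSpace.comap (f ∘ Z) inferInstance]
        =ᵐ[μ]
      μ[Set.indicator (A ⁻¹' B) (fun _ => (1 : ℝ)) |
          MeasurableSpace.comap (f ∘ Z) inferInstance]
        * μ[Set.indicator (Y ⁻¹' C) (fun _ => (1 : ℝ)) |
            MeasurableSpace.comap (f ∘ Z) inferInstance] := by
  intro B C hB hC
  refine condExp_eq_mul_of_condExp_eq_of_le ?_ hZ.comap_le (hCI B C hB hC) (hbal B hB)
  rw [← MeasurableSpace.comap_comp]
  exact MeasurableSpace.comap_mono hf.comap_le
end

section
/- Suppose that for every measurable set C ⊆ β the conditional expectation μ⟦1_{Y⁻¹(C)} | σ(A, Z)⟧ is μ-a.e. equal to μ⟦1_{Y⁻¹(C)} | σ(f ∘ Z)⟧ (i.e., the conditional law of the outcome given the treatment and the confounder is a function of f(Z) alone; this combines unconfoundedness given Z with σ(f∘Z)-measurability of P(Y | A, Z)). Then A and Y are conditionally independent given σ(f ∘ Z). (This is the outcome-model case (i) of the paper's Theorem 1: if P(Y | A, Z) is γ(Z)-measurable, then γ(Z) suffices to block the backdoor paths between A and Y.) -/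
open MeasureTheory

/-- If the conditional probability of `t` given `m'` agrees with the one given a smaller
σ-algebra `m`, then `t` is conditionally independent given `m` of every `m'`-measurable set. -/
lemma condExp_indicator_inter_eq_mul {Ω : Type*} {m m' m₀ : MeasurableSpace Ω}
    {μ : Measure Ω} [IsFiniteMeasure μ] (hmm' : m ≤ m') (hm' : m' ≤ m₀) {s t : Set Ω}
    (hs : MeasurableSet[m'] s) (ht : MeasurableSet[m₀] t)
    (h : μ[t.indicator (fun _ => (1 : ℝ)) | m'] =ᵐ[μ] μ[t.indicator (fun _ => (1 : ℝ)) | m]) :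
    μ[(s ∩ t).indicator (fun _ => (1 : ℝ)) | m]
      =ᵐ[μ] μ[s.indicator (fun _ => (1 : ℝ)) | m] * μ[t.indicator (fun _ => (1 : ℝ)) | m] := by
  have hint : ∀ u : Set Ω, MeasurableSet[m₀] u →
      Integrable (u.indicator (fun _ => (1 : ℝ))) μ :=
    fun u hu => (integrable_const 1).indicator hu
  have hmul : ∀ g : Ω → ℝ, s.indicator g = s.indicator (fun _ => (1 : ℝ)) * g := by
    intro g
    ext ω
    by_cases hω : ω ∈ s <;> simp [hω]
  have hinner : μ[(s ∩ t).indicator (fun _ => (1 : ℝ)) | m']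
      =ᵐ[μ] s.indicator (fun _ => (1 : ℝ)) * μ[t.indicator (fun _ => (1 : ℝ)) | m] := by
    rw [← Set.indicator_indicator, ← hmul]
    exact (condExp_indicator (hint t ht) hs).trans (h.mono fun ω hω => by
      simp only [Set.indicator, hω])
  have hprod : Integrable
      (s.indicator (fun _ => (1 : ℝ)) * μ[t.indicator (fun _ => (1 : ℝ)) | m]) μ := by
    rw [← hmul]
    exact integrable_condExp.indicator (hm' s hs)
  calc μ[(s ∩ t).indicator (fun _ => (1 : ℝ)) | m]
      =ᵐ[μ] μ[μ[(s ∩ t).indicator (fun _ => (1 : ℝ)) | m'] | m] :=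
        (condExp_condExp_of_le hmm' hm').symm
    _ =ᵐ[μ] μ[s.indicator (fun _ => (1 : ℝ)) * μ[t.indicator (fun _ => (1 : ℝ)) | m] | m] :=
        condExp_congr_ae hinner
    _ =ᵐ[μ] μ[s.indicator (fun _ => (1 : ℝ)) | m] * μ[t.indicator (fun _ => (1 : ℝ)) | m] :=
        condExp_mul_of_stronglyMeasurable_right stronglyMeasurable_condExp hprod
          (hint s (hm' s hs))

/-- Outcome-model case (i) of Theorem 1: if the conditional law of the outcome `Y` given
`σ(A, Z)` coincides a.e. with that given `σ(f ∘ Z)`, then `A` and `Y` are conditionally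
independent given `σ(f ∘ Z)`. -/
theorem condIndep_of_outcome_model
    {Ω α β γ γ' : Type*} [MeasurableSpace Ω] [StandardBorelSpace Ω]
    [MeasurableSpace α] [MeasurableSpace β] [MeasurableSpace γ] [MeasurableSpace γ']
    (μ : Measure Ω) [IsProbabilityMeasure μ]
    {A : Ω → α} {Y : Ω → β} {Z : Ω → γ} {f : γ → γ'}
    (hA : Measurable A) (hY : Measurable Y) (hZ : Measurable Z) (hf : Measurable f)
    (hout : ∀ (C : Set β), MeasurableSet C →
      μ[Set.indicator (Y ⁻¹' C) (fun _ => (1 : ℝ)) |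
          MeasurableSpace.comap (fun ω => (A ω, Z ω)) inferInstance]
        =ᵐ[μ]
      μ[Set.indicator (Y ⁻¹' C) (fun _ => (1 : ℝ)) |
          MeasurableSpace.comap (f ∘ Z) inferInstance]) :
    ∀ (B : Set α) (C : Set β), MeasurableSet B → MeasurableSet C →
      μ[Set.indicator (A ⁻¹' B ∩ Y ⁻¹' C) (fun _ => (1 : ℝ)) |
          MeasurableSpace.comap (f ∘ Z) inferInstance]
        =ᵐ[μ]
      μ[Set.indicator (A ⁻¹' B) (fun _ => (1 : ℝ)) |
          MeasurableSpace.comap (f ∘ Z) inferInstance]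
        * μ[Set.indicator (Y ⁻¹' C) (fun _ => (1 : ℝ)) |
            MeasurableSpace.comap (f ∘ Z) inferInstance] := by
  intro B C hB hC
  refine condExp_indicator_inter_eq_mul ?_ (hA.prodMk hZ).comap_le ?_ (hY hC) (hout C hC)
  · rintro _ ⟨D, hD, rfl⟩
    exact ⟨Prod.snd ⁻¹' (f ⁻¹' D), measurable_snd (hf hD), rfl⟩
  · exact ⟨Prod.fst ⁻¹' B, measurable_fst hB, rfl⟩
end

section
/- Suppose that for every measurable set B ⊆ α the conditional expectation μ⟦1_{A⁻¹(B)} | σ(Z)⟧ is μ-a.e. equal to μ⟦1_{A⁻¹(B)} | σ(f ∘ Z)⟧. Then A and Z are conditionally independent given σ(f ∘ Z). (This is the balancing-score property underlying the paper's Theorem 1: when the propensity of the treatment given Z is a function of γ(Z), the treatment is independent of the full confounder Z conditional on γ(Z).) -/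
open MeasureTheory

/-- If conditioning an integrable `g` on the larger σ-algebra `m₂` gives the same result as
conditioning on `m₁ ≤ m₂`, then `g` and indicators of `m₂`-measurable sets are conditionally
uncorrelated given `m₁`. -/
theorem condExp_indicator_ae_eq_mul_of_condExp_ae_eq {Ω : Type*}
    {m₁ m₂ m₀ : MeasurableSpace Ω} {μ : Measure Ω} [IsFiniteMeasure μ] (h₁₂ : m₁ ≤ m₂)
    (h₂ : m₂ ≤ m₀) {g : Ω → ℝ} (hg : Integrable g μ) {t : Set Ω} (ht : MeasurableSet[m₂] t)
    (h : μ[g | m₂] =ᵐ[μ] μ[g | m₁]) :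
    μ[t.indicator g | m₁] =ᵐ[μ] μ[g | m₁] * μ[t.indicator (fun _ => (1 : ℝ)) | m₁] := by
  have hmul : t.indicator (μ[g | m₁]) = μ[g | m₁] * t.indicator (fun _ => (1 : ℝ)) := by
    ext ω
    by_cases hω : ω ∈ t <;> simp [hω]
  calc
    μ[t.indicator g | m₁] =ᵐ[μ] μ[μ[t.indicator g | m₂] | m₁] :=
      (condExp_condExp_of_le h₁₂ h₂).symm
    _ =ᵐ[μ] μ[t.indicator (μ[g | m₁]) | m₁] := by
      refine condExp_congr_ae ((condExp_indicator hg ht).trans ?_)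
      filter_upwards [h] with ω hω
      simp only [Set.indicator, hω]
    _ =ᵐ[μ] μ[g | m₁] * μ[t.indicator (fun _ => (1 : ℝ)) | m₁] := by
      rw [hmul]
      refine condExp_mul_of_stronglyMeasurable_left stronglyMeasurable_condExp ?_
        ((integrable_const 1).indicator (h₂ t ht))
      rw [← hmul]
      exact integrable_condExp.indicator (h₂ t ht)

/-- Balancing-score property underlying Theorem 1: when the propensity of the treatment `A`
given `Z` is a function of `f(Z)` (its conditional law given `σ(Z)` coincides a.e. with that
given `σ(f ∘ Z)`), then `A` and `Z` are conditionally independent given `σ(f ∘ Z)`. -/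
theorem condIndep_treatment_confounder_of_balancing
    {Ω α γ γ' : Type*} [MeasurableSpace Ω] [StandardBorelSpace Ω]
    [MeasurableSpace α] [MeasurableSpace γ] [MeasurableSpace γ']
    (μ : Measure Ω) [IsProbabilityMeasure μ]
    {A : Ω → α} {Z : Ω → γ} {f : γ → γ'}
    (hA : Measurable A) (hZ : Measurable Z) (hf : Measurable f)
    (hbal : ∀ (B : Set α), MeasurableSet B →
      μ[Set.indicator (A ⁻¹' B) (fun _ => (1 : ℝ)) | MeasurableSpace.comap Z inferInstance]
        =ᵐ[μ]
      μ[Set.indicator (A ⁻¹' B) (fun _ => (1 : ℝ)) |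
          MeasurableSpace.comap (f ∘ Z) inferInstance]) :
    ∀ (B : Set α) (D : Set γ), MeasurableSet B → MeasurableSet D →
      μ[Set.indicator (A ⁻¹' B ∩ Z ⁻¹' D) (fun _ => (1 : ℝ)) |
          MeasurableSpace.comap (f ∘ Z) inferInstance]
        =ᵐ[μ]
      μ[Set.indicator (A ⁻¹' B) (fun _ => (1 : ℝ)) |
          MeasurableSpace.comap (f ∘ Z) inferInstance]
        * μ[Set.indicator (Z ⁻¹' D) (fun _ => (1 : ℝ)) |
            MeasurableSpace.comap (f ∘ Z) inferInstance] := by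
  intro B D hB hD
  have hle : MeasurableSpace.comap (f ∘ Z) inferInstance ≤
      MeasurableSpace.comap Z inferInstance := by
    rw [← MeasurableSpace.comap_comp]
    exact MeasurableSpace.comap_mono hf.comap_le
  rw [Set.inter_comm, ← Set.indicator_indicator]
  exact condExp_indicator_ae_eq_mul_of_condExp_ae_eq hle hZ.comap_le
    ((integrable_const 1).indicator (hA hB)) ⟨D, hD, rfl⟩ (hbal B hB)
end
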